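/- The map Φ : (0,∞)² → (0,∞) × ℝ defined by Φ(p_L, p_R) = (√(2 p_L p_R), (p_R − p_L)/√2) is a bijection, with inverse (m, p₁) ↦ ((ω_m(p₁) − p₁)/√2, (ω_m(p₁) + p₁)/√2), and the pushforward under Φ of the measure on (0,∞)² with density p_L · p_R with respect to Lebesgue measure equals the measure on (0,∞) × ℝ with density (m, p₁) ↦ m³/(2 ω_m(p₁)) with respect to Lebesgue measure. -/

import Mathlib

open MeasureTheory Set

/-- The change of variables from lightlike momentum coordinates `(p_L, p_R)` to
mass–momentum coordinates `(m, p₁) = (√(2 p_L p_R), (p_R − p_L)/√2)`. -/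
noncomputable def lightlikeToMass (q : ℝ × ℝ) : ℝ × ℝ :=
  (Real.sqrt (2 * q.1 * q.2), (q.2 - q.1) / Real.sqrt 2)

/-- The inverse change of variables
`(m, p₁) ↦ ((ω_m(p₁) − p₁)/√2, (ω_m(p₁) + p₁)/√2)` with `ω_m(p₁) = √(m² + p₁²)`. -/
noncomputable def massToLightlike (q : ℝ × ℝ) : ℝ × ℝ :=
  ((Real.sqrt (q.1 ^ 2 + q.2 ^ 2) - q.2) / Real.sqrt 2,
   (Real.sqrt (q.1 ^ 2 + q.2 ^ 2) + q.2) / Real.sqrt 2)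

/-- The Fréchet derivative of `lightlikeToMass`. -/
noncomputable def fderivLightlikeToMass (q : ℝ × ℝ) : ℝ × ℝ →L[ℝ] ℝ × ℝ :=
  LinearMap.toContinuousLinearMap (Matrix.toLin (Module.Basis.finTwoProd ℝ)
    (Module.Basis.finTwoProd ℝ)
    !![q.2 / √(2 * q.1 * q.2), q.1 / √(2 * q.1 * q.2); -(1 / √2), 1 / √2])

theorem hasFDerivAt_lightlikeToMass {q : ℝ × ℝ} (h₁ : 0 < q.1) (h₂ : 0 < q.2) :
    HasFDerivAt lightlikeToMass (fderivLightlikeToMass q) q := by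
  have hpos : 0 < 2 * q.1 * q.2 := by positivity
  rw [fderivLightlikeToMass, Matrix.toLin_finTwoProd_toContinuousLinearMap]
  have hf : HasFDerivAt (fun q : ℝ × ℝ => q.1) (ContinuousLinearMap.fst ℝ ℝ ℝ) q := hasFDerivAt_fst
  have hs : HasFDerivAt (fun q : ℝ × ℝ => q.2) (ContinuousLinearMap.snd ℝ ℝ ℝ) q := hasFDerivAt_snd
  have hm := ((hf.const_mul 2).mul hs).sqrt hpos.ne'
  have hp := (hs.sub hf).mul_const (√2)⁻¹
  convert! hm.prodMk hp using 1
  ext <;> simp <;> field_simp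

theorem det_fderivLightlikeToMass (q : ℝ × ℝ) :
    (fderivLightlikeToMass q).det = (q.1 + q.2) / (√2 * √(2 * q.1 * q.2)) := by
  rw [fderivLightlikeToMass, LinearMap.det_toContinuousLinearMap, LinearMap.det_toLin,
    Matrix.det_fin_two_of]
  ring

theorem sqrt_lightlikeToMass {q : ℝ × ℝ} (h₁ : 0 < q.1) (h₂ : 0 < q.2) :
    √((lightlikeToMass q).1 ^ 2 + (lightlikeToMass q).2 ^ 2) = (q.1 + q.2) / √2 := by
  rw [Real.sqrt_eq_iff_mul_self_eq (by positivity) (by positivity)]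
  simp only [lightlikeToMass]
  rw [Real.sq_sqrt (by positivity), div_pow, ← sq, div_pow, Real.sq_sqrt zero_le_two]
  ring

theorem massToLightlike_lightlikeToMass {q : ℝ × ℝ} (h₁ : 0 < q.1) (h₂ : 0 < q.2) :
    massToLightlike (lightlikeToMass q) = q := by
  rw [massToLightlike, sqrt_lightlikeToMass h₁ h₂]
  simp only [lightlikeToMass]
  ext <;> simp only <;> field_simp <;> rw [Real.sq_sqrt zero_le_two] <;> ring

theorem abs_lt_sqrt_sq_add_sq {m : ℝ} (hm : 0 < m) (p : ℝ) : |p| < √(m ^ 2 + p ^ 2) := by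
  rw [Real.lt_sqrt (abs_nonneg p), sq_abs]
  have : 0 < m ^ 2 := by positivity
  linarith

theorem mapsTo_massToLightlike :
    MapsTo massToLightlike (Ioi (0:ℝ) ×ˢ (univ : Set ℝ)) (Ioi (0:ℝ) ×ˢ Ioi (0:ℝ)) := by
  rintro ⟨m, p⟩ ⟨hm, -⟩
  obtain ⟨h₁, h₂⟩ := abs_lt.1 (abs_lt_sqrt_sq_add_sq hm p)
  have h2 : 0 < √(2 : ℝ) := by positivity
  exact ⟨div_pos (sub_pos.2 h₂) h2, div_pos (neg_lt_iff_pos_add'.1 h₁) h2⟩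

theorem mapsTo_lightlikeToMass :
    MapsTo lightlikeToMass (Ioi (0:ℝ) ×ˢ Ioi (0:ℝ)) (Ioi (0:ℝ) ×ˢ (univ : Set ℝ)) := by
  rintro ⟨a, b⟩ ⟨ha, hb⟩
  have ha' : 0 < a := ha
  have hb' : 0 < b := hb
  refine ⟨?_, mem_univ _⟩
  change 0 < √(2 * a * b)
  positivity

theorem lightlikeToMass_massToLightlike {q : ℝ × ℝ} (hm : 0 < q.1) :
    lightlikeToMass (massToLightlike q) = q := by
  have h2 : √2 ^ 2 = 2 := Real.sq_sqrt zero_le_two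
  have hw : √(q.1 ^ 2 + q.2 ^ 2) ^ 2 = q.1 ^ 2 + q.2 ^ 2 := Real.sq_sqrt (by positivity)
  simp only [lightlikeToMass, massToLightlike]
  ext <;> simp only
  · rw [Real.sqrt_eq_iff_mul_self_eq_of_pos hm]
    field_simp
    rw [h2]
    linear_combination -2 * hw
  · field_simp
    rw [h2]
    ring

theorem measurable_lightlikeToMass : Measurable lightlikeToMass := by
  unfold lightlikeToMass
  fun_prop

theorem abs_det_mul_massDensity {q : ℝ × ℝ} (h₁ : 0 < q.1) (h₂ : 0 < q.2) :
    |(fderivLightlikeToMass q).det| * ((lightlikeToMass q).1 ^ 3 /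
      (2 * √((lightlikeToMass q).1 ^ 2 + (lightlikeToMass q).2 ^ 2))) = q.1 * q.2 := by
  rw [det_fderivLightlikeToMass, sqrt_lightlikeToMass h₁ h₂, abs_of_pos (by positivity)]
  simp only [lightlikeToMass]
  have hm : 0 < √(2 * q.1 * q.2) := by positivity
  have hsq : √(2 * q.1 * q.2) ^ 2 = 2 * q.1 * q.2 := Real.sq_sqrt (by positivity)
  have : q.1 + q.2 ≠ 0 := by positivity
  generalize √(2 * q.1 * q.2) = m at hm hsq ⊢
  field_simp
  linarith

/-- `Φ(p_L, p_R) = (√(2 p_L p_R), (p_R − p_L)/√2)` is a bijection of `(0,∞)²` onto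
`(0,∞) × ℝ`, with inverse `(m, p₁) ↦ ((ω_m(p₁) − p₁)/√2, (ω_m(p₁) + p₁)/√2)`, and it pushes
the measure `p_L p_R dp_L dp_R` on `(0,∞)²` forward to `m³/(2ω_m(p₁)) dm dp₁` on `(0,∞) × ℝ`. -/
theorem lightlikeToMass_bijOn_and_map_measure :
    BijOn lightlikeToMass (Ioi (0:ℝ) ×ˢ Ioi (0:ℝ)) (Ioi (0:ℝ) ×ˢ (univ : Set ℝ)) ∧
    (∀ q ∈ Ioi (0:ℝ) ×ˢ Ioi (0:ℝ), massToLightlike (lightlikeToMass q) = q) ∧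
    (∀ q ∈ Ioi (0:ℝ) ×ˢ (univ : Set ℝ), lightlikeToMass (massToLightlike q) = q) ∧
    Measure.map lightlikeToMass
        (((volume : Measure (ℝ × ℝ)).restrict (Ioi (0:ℝ) ×ˢ Ioi (0:ℝ))).withDensity
          (fun q => ENNReal.ofReal (q.1 * q.2))) =
      ((volume : Measure (ℝ × ℝ)).restrict (Ioi (0:ℝ) ×ˢ (univ : Set ℝ))).withDensity
        (fun q => ENNReal.ofReal (q.1 ^ 3 / (2 * Real.sqrt (q.1 ^ 2 + q.2 ^ 2)))) := by
  have hleft : ∀ q ∈ Ioi (0:ℝ) ×ˢ Ioi (0:ℝ), massToLightlike (lightlikeToMass q) = q :=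
    fun q hq => massToLightlike_lightlikeToMass hq.1 hq.2
  have hright : ∀ q ∈ Ioi (0:ℝ) ×ˢ (univ : Set ℝ), lightlikeToMass (massToLightlike q) = q :=
    fun q hq => lightlikeToMass_massToLightlike hq.1
  have hbij : BijOn lightlikeToMass (Ioi (0:ℝ) ×ˢ Ioi (0:ℝ)) (Ioi (0:ℝ) ×ˢ (univ : Set ℝ)) :=
    InvOn.bijOn ⟨hleft, hright⟩ mapsTo_lightlikeToMass mapsTo_massToLightlike
  refine ⟨hbij, hleft, hright, ?_⟩
  ext s hs
  have hpre : MeasurableSet (lightlikeToMass ⁻¹' s) := measurable_lightlikeToMass hs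
  have hQ : MeasurableSet (Ioi (0:ℝ) ×ˢ Ioi (0:ℝ)) := measurableSet_Ioi.prod measurableSet_Ioi
  have himage : lightlikeToMass '' (lightlikeToMass ⁻¹' s ∩ Ioi (0:ℝ) ×ˢ Ioi (0:ℝ)) =
      s ∩ Ioi (0:ℝ) ×ˢ (univ : Set ℝ) := by
    rw [inter_comm, image_inter_preimage, hbij.image_eq, inter_comm]
  rw [Measure.map_apply measurable_lightlikeToMass hs, withDensity_apply _ hpre,
    withDensity_apply _ hs, Measure.restrict_restrict hpre, Measure.restrict_restrict hs, ← himage,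
    lintegral_image_eq_lintegral_abs_det_fderiv_mul volume (hpre.inter hQ)
      (fun q hq => (hasFDerivAt_lightlikeToMass hq.2.1 hq.2.2).hasFDerivWithinAt)
      (hbij.injOn.mono inter_subset_right)]
  refine setLIntegral_congr_fun (hpre.inter hQ) fun q hq => ?_
  rw [← ENNReal.ofReal_mul (abs_nonneg _), abs_det_mul_massDensity hq.2.1 hq.2.2]
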